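/- Let k be a field. There do not exist nonzero homogeneous polynomials q and p in k[X_1, X_2, X_3] satisfying q²·X_3 = −q·p·X_2 − p²·X_1. -/

import Mathlib

open MvPolynomial in
/-- there are no nonzero homogeneous polynomials `q, p` in `k[X₁,X₂,X₃]`
with `q²·X₃ = -q·p·X₂ - p²·X₁` (here `X₁ = X 0`, `X₂ = X 1`, `X₃ = X 2`). -/
theorem stmt12 {k : Type*} [Field k] :
    ¬ ∃ (q p : MvPolynomial (Fin 3) k) (d e : ℕ),
      q ≠ 0 ∧ p ≠ 0 ∧ q.IsHomogeneous d ∧ p.IsHomogeneous e ∧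
      q ^ 2 * X 2 = -(q * p * X 1) - p ^ 2 * X 0 := by
  rintro ⟨q, p, -, -, hq, hp, -, -, h⟩
  -- Compare degrees in `X 2`: with `a`, `b` those of `q`, `p`, they are `2a + 1`, `a + b`, `2b`.
  have degree_q : degreeOf 2 (q ^ 2 * X 2) = 2 * degreeOf 2 q + 1 := by
    rw [degreeOf_mul_eq (pow_ne_zero 2 hq) (X_ne_zero 2), degreeOf_pow_eq _ _ _ hq]
    simp
  have degree_p : degreeOf 2 (p ^ 2 * X 0) = 2 * degreeOf 2 p := by
    rw [degreeOf_mul_eq (pow_ne_zero 2 hp) (X_ne_zero 0), degreeOf_pow_eq _ _ _ hp]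
    simp [degreeOf_X]
  have degree_qp : degreeOf 2 (q * p * X 1) = degreeOf 2 q + degreeOf 2 p := by
    rw [degreeOf_mul_eq (mul_ne_zero hq hp) (X_ne_zero 1), degreeOf_mul_eq hq hp]
    simp [degreeOf_X]
  have bound_q := degreeOf_sub_le 2 (-(q * p * X 1)) (p ^ 2 * X 0)
  rw [← h, degreeOf_neg] at bound_q
  have bound_p := degreeOf_sub_le 2 (-(q * p * X 1)) (q ^ 2 * X 2)
  rw [show -(q * p * X 1) - q ^ 2 * X 2 = p ^ 2 * X 0 by rw [h]; ring, degreeOf_neg] at bound_p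
  omega
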